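/- Let G = (V,E) be a fully regular finite connected simple graph with n vertices, independence number α, and constants a_0 = n, a_1, …, a_α. Then the number of successive vertex orderings of G equals a_0! · Σ_{i=0}^{α} ∏_{j=1}^{i} (−a_j)/(a_0 − a_j). -/

import Mathlib

open Finset Polynomial

variable {V : Type*} [Fintype V] [DecidableEq V]

/-- The closed neighbourhood `N[I]` of a set of vertices `I`. -/
def closedNbhd (G : SimpleGraph V) [DecidableRel G.Adj] (I : Finset V) : Finset V :=
  I ∪ I.biUnion fun v => G.neighborFinset v

/-- `a(I) = |V \ N[I]| = n - |N[I]|`. -/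
def aPar (G : SimpleGraph V) [DecidableRel G.Adj] (I : Finset V) : ℕ :=
  Fintype.card V - (closedNbhd G I).card

/-- `I` is an independent set: no two of its vertices are adjacent. -/
def IsIndep (G : SimpleGraph V) (I : Finset V) : Prop :=
  ∀ u ∈ I, ∀ v ∈ I, ¬ G.Adj u v

instance (G : SimpleGraph V) [DecidableRel G.Adj] : DecidablePred (IsIndep G) :=
  fun I => inferInstanceAs (Decidable (∀ u ∈ I, ∀ v ∈ I, ¬ G.Adj u v))

/-- For a list `ρ = (ρ₁, …, ρ_k)`, the product `∏_{j=1}^k 1/(n - a({ρ_j, …, ρ_k}))`. -/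
def prodTerm (G : SimpleGraph V) [DecidableRel G.Adj] : List V → ℚ
  | [] => 1
  | v :: l =>
      (1 / ((Fintype.card V : ℚ) - (aPar G (v :: l).toFinset : ℚ))) * prodTerm G l

/-- `b(I)`: the sum over all permutations `ρ` of `I` of
`∏_{j=1}^k 1/(n - a({ρ_j, …, ρ_k}))`; in particular `b(∅) = 1`. -/
noncomputable def bPar (G : SimpleGraph V) [DecidableRel G.Adj] (I : Finset V) : ℚ :=
  (I.toList.permutations.map (prodTerm G)).sum

/-- A linear ordering `π : V ≃ Fin n` is successive if every vertex which is not first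
has a neighbour appearing earlier. -/
def IsSuccessive (G : SimpleGraph V) (π : V ≃ Fin (Fintype.card V)) : Prop :=
  ∀ v : V, (π v : ℕ) ≠ 0 → ∃ u : V, G.Adj u v ∧ π u < π v

/-- `σ(G)`: the number of successive linear orderings of the vertices of `G`. -/
noncomputable def sigmaG (G : SimpleGraph V) : ℕ :=
  Nat.card {π : V ≃ Fin (Fintype.card V) // IsSuccessive G π}

/-- Vertex `v` is bad in the ordering `π`: it is not first, yet appears before
all of its neighbours. -/
def IsBad (G : SimpleGraph V) (π : V ≃ Fin (Fintype.card V)) (v : V) : Prop :=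
  (π v : ℕ) ≠ 0 ∧ ∀ u : V, G.Adj u v → π v < π u

/-- Vertex `v` is good in the ordering `π`: it is first or some neighbour appears earlier. -/
def IsGood (G : SimpleGraph V) (π : V ≃ Fin (Fintype.card V)) (v : V) : Prop :=
  (π v : ℕ) = 0 ∨ ∃ u : V, G.Adj u v ∧ π u < π v

/-- For each `j`, the vertex `ρ_j` is the earliest element of `N[{ρ_j, …, ρ_k}]` under `π`. -/
def EarliestAll (G : SimpleGraph V) [DecidableRel G.Adj]
    (π : V ≃ Fin (Fintype.card V)) : List V → Prop
  | [] => True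
  | v :: l =>
      (∀ u ∈ closedNbhd G (v :: l).toFinset, u ≠ v → π v < π u) ∧ EarliestAll G π l

/-- The event `C_ρ`: the vertices of `ρ` appear in the relative order
`ρ₁ ≺ ρ₂ ≺ ⋯ ≺ ρ_k`, and each `ρ_j` is the earliest element of `N[{ρ_j, …, ρ_k}]`. -/
def CEvent (G : SimpleGraph V) [DecidableRel G.Adj]
    (π : V ≃ Fin (Fintype.card V)) (ρ : List V) : Prop :=
  ρ.Chain' (fun a b => π a < π b) ∧ EarliestAll G π ρ

/-- The weight `w(I) = (a(I)/n) · b(I)`. -/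
noncomputable def wPar (G : SimpleGraph V) [DecidableRel G.Adj] (I : Finset V) : ℚ :=
  ((aPar G I : ℚ) / (Fintype.card V : ℚ)) * bPar G I

/-- The successive ordering polynomial `P_G(x) = Σ_I w(I) x^{|I|}` over independent sets. -/
noncomputable def PG (G : SimpleGraph V) [DecidableRel G.Adj] : Polynomial ℚ :=
  ∑ I ∈ Finset.univ.filter (fun I : Finset V => IsIndep G I),
    Polynomial.C (wPar G I) * Polynomial.X ^ I.card

/-- `r(π)`: the number of bad vertices of the ordering `π`. -/
noncomputable def badCount (G : SimpleGraph V) (π : V ≃ Fin (Fintype.card V)) : ℕ :=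
  Nat.card {v : V // IsBad G π v}

/-- Closed neighbourhood inside the induced subgraph on the vertex set `W`. -/
def closW (G : SimpleGraph V) [DecidableRel G.Adj] (W I : Finset V) : Finset V :=
  closedNbhd G I ∩ W

/-- The parameter `a` computed in the induced subgraph on `W`. -/
def aW (G : SimpleGraph V) [DecidableRel G.Adj] (W I : Finset V) : ℕ :=
  W.card - (closW G W I).card

/-- The product term computed in the induced subgraph on `W`. -/
def prodTermW (G : SimpleGraph V) [DecidableRel G.Adj] (W : Finset V) : List V → ℚ
  | [] => 1
  | v :: l => (1 / ((W.card : ℚ) - (aW G W (v :: l).toFinset : ℚ))) * prodTermW G W l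

/-- The parameter `b` computed in the induced subgraph on `W`. -/
noncomputable def bW (G : SimpleGraph V) [DecidableRel G.Adj] (W I : Finset V) : ℚ :=
  (I.toList.permutations.map (prodTermW G W)).sum

/-- The weight `w` computed in the induced subgraph on `W`. -/
noncomputable def wW (G : SimpleGraph V) [DecidableRel G.Adj] (W I : Finset V) : ℚ :=
  ((aW G W I : ℚ) / (W.card : ℚ)) * bW G W I

/-- The successive ordering polynomial of the induced subgraph on `W`. -/
noncomputable def PW (G : SimpleGraph V) [DecidableRel G.Adj] (W : Finset V) : Polynomial ℚ :=
  ∑ I ∈ W.powerset.filter (fun I : Finset V => IsIndep G I),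
    Polynomial.C (wW G W I) * Polynomial.X ^ I.card

/-- The multivariate successive ordering polynomial `𝒫_G(x) = Σ_I w(I) ∏_{v ∈ I} x_v`. -/
noncomputable def mvP (G : SimpleGraph V) [DecidableRel G.Adj] : MvPolynomial V ℚ :=
  ∑ I ∈ Finset.univ.filter (fun I : Finset V => IsIndep G I),
    MvPolynomial.C (wPar G I) * ∏ v ∈ I, MvPolynomial.X v

/-- The lists enumerating each element of `W` exactly once. -/
def Finset.orderings {α : Type*} (W : Finset α) : Finset (List α) :=
  ⟨W.val.lists, Multiset.lists_nodup_finset W⟩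

theorem Finset.mem_orderings {α : Type*} {W : Finset α} {l : List α} :
    l ∈ W.orderings ↔ W.val = l :=
  Multiset.mem_lists_iff _ _

theorem Finset.card_filter_orderings {α : Type*} [DecidableEq α] {W : Finset α}
    (hW : W.Nonempty) (p : List α → Prop) [DecidablePred p] :
    #{l ∈ W.orderings | p l} = ∑ x ∈ W, #{l ∈ (W.erase x).orderings | p (x :: l)} := by
  have key : ({l ∈ W.orderings | p l} : Finset (List α)) =
      W.biUnion fun x => ({l ∈ (W.erase x).orderings | p (x :: l)}).image (x :: ·) := by
    ext l
    simp only [mem_filter, mem_orderings, mem_biUnion, mem_image, erase_val]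
    constructor
    · rintro ⟨h, hp⟩
      cases l with
      | nil => exact absurd h (by simpa using hW.ne_empty)
      | cons x t =>
        replace h : W.val = x ::ₘ (t : Multiset α) := h
        refine ⟨x, ?_, t, ⟨?_, hp⟩, rfl⟩
        · rw [mem_def, h]; simp
        · rw [h]; simp
    · rintro ⟨x, hx, t, ⟨ht, hp⟩, rfl⟩
      refine ⟨?_, hp⟩
      rw [← Multiset.cons_erase (mem_def.1 hx), ht]; rfl
  rw [key, card_biUnion]
  · exact sum_congr rfl fun x _ => card_image_of_injective _ fun _ _ h => (List.cons.inj h).2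
  · intro x _ y _ hxy
    simp only [Function.onFun, disjoint_left, mem_image]
    rintro _ ⟨s, _, rfl⟩ ⟨t, _, h⟩
    exact hxy (List.cons.inj h).1.symm

/-- Every vertex of `I` comes before all of its neighbours in the list `l`. -/
def IsEarly (G : SimpleGraph V) (I : Finset V) (l : List V) : Prop :=
  ∀ v ∈ I, ∀ u, G.Adj u v → l.idxOf v < l.idxOf u

theorem isEarly_cons {α : Type*} [DecidableEq α] (G : SimpleGraph α) (I : Finset α) (x : α)
    (l : List α) :
    IsEarly G I (x :: l) ↔ (∀ v ∈ I, ¬ G.Adj x v) ∧ IsEarly G (I.erase x) l := by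
  unfold IsEarly
  constructor
  · intro h
    refine ⟨fun v hv hx => by simpa using h v hv x hx, fun v hv u hu => ?_⟩
    replace ⟨hvx, hv⟩ := mem_erase.1 hv
    have hux : u ≠ x := by
      rintro rfl
      simpa using h v hv u hu
    have := h v hv u hu
    rwa [List.idxOf_cons_ne _ hvx.symm, List.idxOf_cons_ne _ hux.symm,
      Nat.succ_lt_succ_iff] at this
  · rintro ⟨h₁, h₂⟩ v hv u hu
    have hux : u ≠ x := by
      rintro rfl
      exact h₁ v hv hu
    rw [List.idxOf_cons_ne _ hux.symm]
    by_cases hvx : v = x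
    · subst hvx
      simp
    · rw [List.idxOf_cons_ne _ (Ne.symm hvx), Nat.succ_lt_succ_iff]
      exact h₂ v (mem_erase.2 ⟨hvx, hv⟩) u hu

theorem mem_closedNbhd {G : SimpleGraph V} [DecidableRel G.Adj] {I : Finset V} {x : V} :
    x ∈ closedNbhd G I ↔ x ∈ I ∨ ∃ v ∈ I, G.Adj x v := by
  simp [closedNbhd, G.adj_comm x]

theorem IsIndep.mono {α : Type*} {G : SimpleGraph α} {I J : Finset α} (hJ : IsIndep G J) (h : I ⊆ J) :
    IsIndep G I :=
  fun u hu v hv => hJ u (h hu) v (h hv)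

theorem card_closedNbhd {G : SimpleGraph V} [DecidableRel G.Adj] {a : ℕ → ℕ}
    (ha0 : a 0 = Fintype.card V)
    (hreg : ∀ I : Finset V, IsIndep G I → aPar G I = a I.card) {I : Finset V}
    (hI : IsIndep G I) : (#(closedNbhd G I) : ℚ) = a 0 - a #I := by
  have h := hreg I hI
  have h' := card_le_univ (closedNbhd G I)
  unfold aPar at h
  rw [ha0, ← h, Nat.cast_sub h']
  ring

open Classical in
theorem card_isEarly {G : SimpleGraph V} [DecidableRel G.Adj] {a : ℕ → ℕ}
    (ha0 : a 0 = Fintype.card V)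
    (hreg : ∀ I : Finset V, IsIndep G I → aPar G I = a I.card) (W : Finset V) :
    ∀ I : Finset V, IsIndep G I → closedNbhd G I ⊆ W →
      (#{l ∈ W.orderings | IsEarly G I l} : ℚ) =
        (#W).factorial * (#I).factorial * ∏ j ∈ Icc 1 #I, ((a 0 : ℚ) - a j)⁻¹ := by
  induction W using Finset.strongInduction with
  | H W ih =>
  intro I hI hIW
  obtain rfl | hW := W.eq_empty_or_nonempty
  · have hI0 : I = ∅ := by
      rw [eq_empty_iff_forall_notMem]
      exact fun x hx => notMem_empty x (hIW (mem_closedNbhd.2 (Or.inl hx)))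
    subst hI0
    have : ({l ∈ (∅ : Finset V).orderings | IsEarly G ∅ l} : Finset (List V)) = {[]} := by
      ext l
      simp only [mem_filter, mem_orderings, mem_singleton, empty_val]
      constructor
      · rintro ⟨h, _⟩
        simpa using h.symm
      · rintro rfl
        exact ⟨rfl, by simp [IsEarly]⟩
    rw [this]; simp
  rw [card_filter_orderings hW]
  simp only [isEarly_cons]
  have hsub : I ⊆ closedNbhd G I := fun x hx => mem_closedNbhd.2 (Or.inl hx)
  have hW1 : ((#W).factorial : ℚ) = #W * (#W - 1).factorial := by
    exact_mod_cast (Nat.mul_factorial_pred hW.card_pos.ne').symm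
  set P : ℕ → ℚ := fun k => k.factorial * ∏ j ∈ Icc 1 k, ((a 0 : ℚ) - a j)⁻¹ with hP
  have hout : ∀ x ∈ W \ closedNbhd G I,
      (#{l ∈ (W.erase x).orderings | (∀ v ∈ I, ¬ G.Adj x v) ∧ IsEarly G (I.erase x) l} : ℚ) =
        (#W - 1).factorial * P #I := by
    intro x hx
    obtain ⟨hxW, hx⟩ := mem_sdiff.1 hx
    have hxI : x ∉ I := fun h => hx (hsub h)
    have hadj : ∀ v ∈ I, ¬ G.Adj x v := fun v hv h => hx (mem_closedNbhd.2 (Or.inr ⟨v, hv, h⟩))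
    simp only [eq_true hadj, erase_eq_of_notMem hxI, true_and]
    rw [ih _ (erase_ssubset hxW) I hI (subset_erase.2 ⟨hIW, hx⟩), card_erase_of_mem hxW, hP]
    ring
  have hin : ∀ x ∈ closedNbhd G I,
      (#{l ∈ (W.erase x).orderings | (∀ v ∈ I, ¬ G.Adj x v) ∧ IsEarly G (I.erase x) l} : ℚ) =
        if x ∈ I then (#W - 1).factorial * P (#I - 1) else 0 := by
    intro x hx
    have hxW := hIW hx
    split_ifs with hxI
    · have hadj : ∀ v ∈ I, ¬ G.Adj x v := hI x hxI
      simp only [eq_true hadj, true_and]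
      have hx' : x ∉ closedNbhd G (I.erase x) := by
        rw [mem_closedNbhd]
        rintro (h | ⟨v, hv, h⟩)
        · simp at h
        · exact hadj v (mem_of_mem_erase hv) h
      have hmono : closedNbhd G (I.erase x) ⊆ closedNbhd G I := by
        intro y
        simp only [mem_closedNbhd]
        rintro (h | ⟨v, hv, h⟩)
        · exact Or.inl (mem_of_mem_erase h)
        · exact Or.inr ⟨v, mem_of_mem_erase hv, h⟩
      rw [ih _ (erase_ssubset hxW) _ (hI.mono (erase_subset _ _))
        (subset_erase.2 ⟨hmono.trans hIW, hx'⟩), card_erase_of_mem hxW, card_erase_of_mem hxI, hP]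
      ring
    · obtain ⟨v, hv, h⟩ := (mem_closedNbhd.1 hx).resolve_left hxI
      rw [Nat.cast_eq_zero, card_eq_zero, filter_eq_empty_iff]
      exact fun l _ hl => hl.1 v hv h
  have hcard := card_closedNbhd ha0 hreg hI
  have hrec : (#I : ℚ) * P (#I - 1) = #(closedNbhd G I) * P #I := by
    obtain h0 | hpos := Nat.eq_zero_or_pos #I
    · simp [card_eq_zero.1 h0, closedNbhd]
    · obtain ⟨k, hk⟩ : ∃ k, #I = k + 1 := ⟨#I - 1, by omega⟩
      have hne : (#(closedNbhd G I) : ℚ) ≠ 0 := by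
        exact_mod_cast (hpos.trans_le (card_le_card hsub)).ne'
      rw [hcard, hk] at *
      simp only [hP, Nat.add_sub_cancel, prod_Icc_succ_top (Nat.le_add_left 1 k),
        Nat.factorial_succ]
      push_cast
      field_simp
  rw [Nat.cast_sum, ← sum_sdiff hIW, sum_congr rfl hout, sum_congr rfl hin, sum_ite_mem,
    inter_eq_right.2 hsub, sum_const, sum_const, nsmul_eq_mul, nsmul_eq_mul,
    card_sdiff_of_subset hIW, Nat.cast_sub (card_le_card hIW), mul_assoc, hW1]
  change _ = _ * P #I
  linear_combination ((#W - 1).factorial : ℚ) * hrec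

theorem card_indep_mul_factorial {G : SimpleGraph V} [DecidableRel G.Adj] {a : ℕ → ℕ}
    (hreg : ∀ I : Finset V, IsIndep G I → aPar G I = a I.card) (k : ℕ) :
    #{I : Finset V | IsIndep G I ∧ #I = k} * k.factorial = ∏ j ∈ range k, a j := by
  induction k with
  | zero =>
    have : ({I : Finset V | IsIndep G I ∧ #I = 0} : Finset (Finset V)) = {∅} := by
      ext I
      simp only [mem_filter, mem_univ, true_and, card_eq_zero, mem_singleton]
      exact ⟨And.right, by rintro rfl; exact ⟨by simp [IsIndep], rfl⟩⟩
    rw [this]; simp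
  | succ k ih =>
    have h := card_mul_eq_card_mul (s := {I : Finset V | IsIndep G I ∧ #I = k})
      (t := {I : Finset V | IsIndep G I ∧ #I = k + 1}) (fun J I => J ⊆ I) (m := a k) (n := k + 1)
      (fun J hJ => ?_) (fun I hI => ?_)
    · rw [prod_range_succ, ← ih, Nat.factorial_succ]
      zify at h ⊢
      linear_combination -(k.factorial : ℤ) * h
    · obtain ⟨hJ, hk⟩ := (mem_filter.1 hJ).2
      have himg : bipartiteAbove (fun J I => J ⊆ I)
          ({I : Finset V | IsIndep G I ∧ #I = k + 1} : Finset (Finset V)) J =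
          (closedNbhd G J)ᶜ.image fun x => insert x J := by
        ext I
        simp only [mem_bipartiteAbove, mem_filter, mem_univ, true_and, mem_image, mem_compl,
          mem_closedNbhd, not_or, not_exists, not_and]
        constructor
        · rintro ⟨⟨hI, hIk⟩, hJI⟩
          obtain ⟨x, hx, rfl⟩ : ∃ x, x ∉ J ∧ insert x J = I := by
            apply (covBy_iff_exists_insert).1
            exact covBy_iff_card_sdiff_eq_one.2 ⟨hJI, by rw [card_sdiff_of_subset hJI]; omega⟩
          exact ⟨x, ⟨hx, fun v hv => hI x (mem_insert_self _ _) v (mem_insert_of_mem hv)⟩, rfl⟩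
        · rintro ⟨x, ⟨hx, hadj⟩, rfl⟩
          refine ⟨⟨?_, by rw [card_insert_of_notMem hx, hk]⟩, subset_insert _ _⟩
          intro u hu v hv
          rw [mem_insert] at hu hv
          obtain rfl | hu := hu <;> obtain rfl | hv := hv
          · exact G.irrefl
          · exact hadj v hv
          · exact fun h => hadj u hu h.symm
          · exact hJ u hu v hv
      rw [himg, card_image_of_injOn, card_compl, ← hk, ← hreg J hJ, aPar]
      intro x hx y hy hxy
      have hx' : x ∉ J := fun h => mem_compl.1 hx (mem_closedNbhd.2 (Or.inl h))
      have : x ∈ insert y J := by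
        rw [← show insert x J = insert y J from hxy]
        exact mem_insert_self _ _
      exact (mem_insert.1 this).resolve_right hx'
    · obtain ⟨hI, hk⟩ := (mem_filter.1 hI).2
      have : bipartiteBelow (fun J I => J ⊆ I)
          ({I : Finset V | IsIndep G I ∧ #I = k} : Finset (Finset V)) I = I.powersetCard k := by
        ext J
        simp only [mem_bipartiteBelow, mem_filter, mem_univ, true_and, mem_powersetCard]
        exact ⟨fun h => ⟨h.2, h.1.2⟩, fun h => ⟨⟨hI.mono h.1, h.2⟩, h.1⟩⟩
      rw [this, card_powersetCard, hk, Nat.choose_succ_self_right]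

/-- The vertices that are not first in `l` but come before all of their neighbours. -/
def badSet (G : SimpleGraph V) [DecidableRel G.Adj] (l : List V) : Finset V :=
  {v | l.idxOf v ≠ 0 ∧ ∀ u, G.Adj u v → l.idxOf v < l.idxOf u}

theorem subset_badSet_cons {G : SimpleGraph V} [DecidableRel G.Adj] {I : Finset V} {x : V}
    {l : List V} :
    I ⊆ badSet G (x :: l) ↔ x ∉ closedNbhd G I ∧ IsEarly G I l := by
  have h : I ⊆ badSet G (x :: l) ↔ x ∉ I ∧ IsEarly G I (x :: l) := by
    simp only [badSet, subset_iff, mem_filter, mem_univ, true_and, IsEarly]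
    refine ⟨fun h => ⟨fun hx => (h hx).1 (by simp), fun v hv => (h hv).2⟩, fun h v hv =>
      ⟨?_, h.2 v hv⟩⟩
    have hvx : x ≠ v := by
      rintro rfl
      exact h.1 hv
    rw [List.idxOf_cons_ne _ hvx]
    exact Nat.succ_ne_zero _
  rw [h, isEarly_cons, mem_closedNbhd]
  push Not
  rw [and_assoc]
  refine and_congr_right fun hx => ?_
  rw [erase_eq_of_notMem hx]

theorem IsIndep.of_subset_badSet {G : SimpleGraph V} [DecidableRel G.Adj] {I : Finset V}
    {l : List V} (h : I ⊆ badSet G l) : IsIndep G I := by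
  intro u hu v hv huv
  have h₁ := (mem_filter.1 (h hv)).2.2 u huv
  have h₂ := (mem_filter.1 (h hu)).2.2 v huv.symm
  omega

theorem card_subset_badSet [Nonempty V] {G : SimpleGraph V} [DecidableRel G.Adj] {a : ℕ → ℕ}
    (ha0 : a 0 = Fintype.card V)
    (hreg : ∀ I : Finset V, IsIndep G I → aPar G I = a I.card) {I : Finset V}
    (hI : IsIndep G I) :
    (#{l ∈ (univ : Finset V).orderings | I ⊆ badSet G l} : ℚ) =
      a #I * (a 0 - 1).factorial * ((#I).factorial * ∏ j ∈ Icc 1 #I, ((a 0 : ℚ) - a j)⁻¹) := by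
  classical
  rw [card_filter_orderings univ_nonempty]
  simp only [subset_badSet_cons]
  have h : ∀ x ∈ (univ : Finset V),
      (#{l ∈ (univ.erase x).orderings | x ∉ closedNbhd G I ∧ IsEarly G I l} : ℚ) =
      if x ∈ (closedNbhd G I)ᶜ then (a 0 - 1).factorial *
        ((#I).factorial * ∏ j ∈ Icc 1 #I, ((a 0 : ℚ) - a j)⁻¹) else 0 := by
    intro x _
    split_ifs with hx
    · rw [mem_compl] at hx
      simp only [eq_true hx, true_and]
      rw [card_isEarly ha0 hreg _ I hI (subset_erase.2 ⟨subset_univ _, hx⟩),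
        card_erase_of_mem (mem_univ x), card_univ, ha0, mul_assoc]
    · rw [mem_compl, not_not] at hx
      simp [hx]
  rw [Nat.cast_sum, sum_congr rfl h, sum_ite_mem, univ_inter, sum_const, nsmul_eq_mul, card_compl,
    ← hreg I hI, aPar, mul_assoc]

theorem idxOf_ofFn_symm (π : V ≃ Fin (Fintype.card V)) (v : V) :
    (List.ofFn π.symm).idxOf v = π v := by
  have h := (List.nodup_ofFn.2 π.symm.injective).idxOf_getElem (π v) (by simp)
  simpa using h

theorem sigmaG_eq_card (G : SimpleGraph V) [DecidableRel G.Adj] :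
    sigmaG G = #{l ∈ (univ : Finset V).orderings | badSet G l = ∅} := by
  have hiff (π : V ≃ Fin (Fintype.card V)) :
      IsSuccessive G π ↔ badSet G (List.ofFn π.symm) = ∅ := by
    simp only [badSet, filter_eq_empty_iff, idxOf_ofFn_symm, mem_univ, true_imp_iff, not_and,
      not_forall, not_lt, IsSuccessive]
    refine forall₂_congr fun v _ => exists_congr fun u => ?_
    rw [exists_prop]
    refine and_congr_right fun huv => ?_
    have hne : π u ≠ π v := fun h => huv.ne (π.injective h)
    rw [Fin.val_fin_le, hne.le_iff_lt]
  have hmem (l : List V) : l ∈ (univ : Finset V).orderings ↔ l.Nodup ∧ ∀ v, v ∈ l := by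
    rw [mem_orderings]
    constructor
    · intro h
      exact ⟨Multiset.coe_nodup.1 (h ▸ univ.nodup),
        fun v => Multiset.mem_coe.1 (h ▸ mem_univ_val v)⟩
    · rintro ⟨h₁, h₂⟩
      exact (Multiset.Nodup.ext univ.nodup (Multiset.coe_nodup.2 h₁)).2 fun v => by simp [h₂]
  classical
  rw [sigmaG, Nat.card_eq_fintype_card, Fintype.card_subtype]
  refine card_bij (fun π _ => List.ofFn π.symm) (fun π hπ => ?_) (fun π _ π' _ h => ?_)
    fun l hl => ?_
  · refine mem_filter.2 ⟨(hmem _).2 ⟨List.nodup_ofFn.2 π.symm.injective, fun v => ?_⟩,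
      (hiff π).1 (mem_filter.1 hπ).2⟩
    exact List.mem_ofFn.2 ⟨π v, by simp⟩
  · ext v
    rw [← idxOf_ofFn_symm, ← idxOf_ofFn_symm, h]
  · obtain ⟨hl, hbad⟩ := mem_filter.1 hl
    obtain ⟨hnd, hall⟩ := (hmem l).1 hl
    have hlen : l.length = Fintype.card V := by
      simpa using Fintype.card_congr (hnd.getEquivOfForallMemList l hall)
    let π : V ≃ Fin (Fintype.card V) :=
      (hnd.getEquivOfForallMemList l hall).symm.trans (finCongr hlen)
    have hπ : List.ofFn π.symm = l := by
      refine List.ext_getElem (by simp [hlen]) fun i _ _ => ?_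
      simp [π]
    exact ⟨π, mem_filter.2 ⟨mem_univ _, (hiff π).2 (hπ.symm ▸ hbad)⟩, hπ⟩

theorem sigmaG_eq_sum (G : SimpleGraph V) [DecidableRel G.Adj] :
    (sigmaG G : ℚ) = ∑ I : Finset V with IsIndep G I,
      (-1) ^ #I * (#{l ∈ (univ : Finset V).orderings | I ⊆ badSet G l} : ℚ) := by
  have hsign (S : Finset V) :
      (if S = ∅ then 1 else 0 : ℚ) = ∑ I : Finset V, if I ⊆ S then (-1) ^ #I else 0 := by
    rw [← sum_filter, filter_subset_univ]
    exact_mod_cast (sum_powerset_neg_one_pow_card (x := S)).symm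
  rw [sigmaG_eq_card, card_filter, Nat.cast_sum]
  simp only [Nat.cast_ite, Nat.cast_one, Nat.cast_zero]
  simp only [hsign]
  rw [sum_comm, sum_filter]
  refine sum_congr rfl fun I _ => ?_
  rw [← sum_filter, sum_const, nsmul_eq_mul, mul_comm]
  split_ifs with hI
  · rfl
  · rw [filter_eq_empty_iff.2 fun l _ h => hI (IsIndep.of_subset_badSet h)]
    simp

/-- For a fully regular connected graph with independence number `α`
and constants `a₀ = n, a₁, …, a_α`,
`σ(G) = a₀! · Σ_{i=0}^{α} ∏_{j=1}^{i} (−a_j)/(a₀ − a_j)`. -/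
theorem fullyRegular_successive_count (G : SimpleGraph V) [DecidableRel G.Adj]
    (hG : G.Connected)
    (α : ℕ) (hmax : ∀ I : Finset V, IsIndep G I → I.card ≤ α)
    (hex : ∃ I : Finset V, IsIndep G I ∧ I.card = α)
    (a : ℕ → ℕ) (ha0 : a 0 = Fintype.card V)
    (hreg : ∀ I : Finset V, IsIndep G I → aPar G I = a I.card) :
    (sigmaG G : ℚ) =
      (Nat.factorial (a 0) : ℚ) *
        ∑ i ∈ Finset.range (α + 1),
          ∏ j ∈ Finset.Icc 1 i, (-(a j : ℚ)) / ((a 0 : ℚ) - (a j : ℚ)) := by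
  have := hG.nonempty
  have hpos : 0 < a 0 := ha0 ▸ Fintype.card_pos
  rw [sigmaG_eq_sum, ← sum_fiberwise_of_maps_to (t := range (α + 1)) (g := card)
    fun I hI => mem_range.2 (Nat.lt_succ_of_le (hmax I (mem_filter.1 hI).2)), mul_sum]
  refine sum_congr rfl fun k _ => ?_
  have hterm : ∀ I ∈ ({I : Finset V | IsIndep G I} : Finset (Finset V)).filter (#· = k),
      (-1) ^ #I * (#{l ∈ (univ : Finset V).orderings | I ⊆ badSet G l} : ℚ) =
      (-1) ^ k * (a k * (a 0 - 1).factorial *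
        (k.factorial * ∏ j ∈ Icc 1 k, ((a 0 : ℚ) - a j)⁻¹)) := by
    intro I hI
    obtain ⟨hI', rfl⟩ := mem_filter.1 hI
    rw [card_subset_badSet ha0 hreg (mem_filter.1 hI').2]
  have hcount : (#{I : Finset V | IsIndep G I ∧ #I = k} : ℚ) * k.factorial * a k =
      a 0 * ∏ j ∈ Icc 1 k, (a j : ℚ) := by
    have h := card_indep_mul_factorial hreg k
    rw [← Nat.cast_mul, h, ← Nat.cast_mul, ← prod_range_succ, prod_range_succ', mul_comm,
      range_eq_Ico, prod_Ico_add' a 0 k 1, zero_add, Ico_add_one_right_eq_Icc, Nat.cast_mul,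
      Nat.cast_prod]
  rw [sum_congr rfl hterm, sum_const, nsmul_eq_mul, filter_filter,
    ← Nat.mul_factorial_pred hpos.ne']
  have hprod : ∏ j ∈ Icc 1 k, -(a j : ℚ) / ((a 0 : ℚ) - a j) =
      (-1) ^ k * (∏ j ∈ Icc 1 k, (a j : ℚ)) * ∏ j ∈ Icc 1 k, ((a 0 : ℚ) - a j)⁻¹ := by
    simp only [div_eq_mul_inv, prod_mul_distrib, prod_neg, Nat.card_Icc, Nat.add_sub_cancel]
  rw [hprod, Nat.cast_mul]
  linear_combination (-1) ^ k * ((a 0 - 1).factorial : ℚ) *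
    (∏ j ∈ Icc 1 k, ((a 0 : ℚ) - a j)⁻¹) * hcount
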